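/- arXiv:1707.08591 — 6 statements merged into one kernel-verified Lean document; each statement's English description precedes it below -/
import Mathlib

section
/- Let × be a cross product on a real inner product space V. Then the Malcev (Lagrange) identity holds: for all A, B ∈ V, A × (A × B) = −‖A‖² B + ⟨A, B⟩ A. -/
open RealInnerProductSpace

/-- For a cross product on a real inner product space, the Malcev
(Lagrange) identity `A × (A × B) = −‖A‖² B + ⟪A, B⟫ A` holds. -/
theorem cross_malcev_identity
    {V : Type*} [NormedAddCommGroup V] [InnerProductSpace ℝ V]
    (cross : V →ₗ[ℝ] V →ₗ[ℝ] V)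
    (h₁ : ∀ A B : V, ⟪cross A B, A⟫ = 0)
    (h₂ : ∀ A B : V, ⟪cross A B, B⟫ = 0)
    (h₃ : ∀ A B : V, ‖cross A B‖ ^ 2 = ‖A‖ ^ 2 * ‖B‖ ^ 2 - ⟪A, B⟫ ^ 2) :
    ∀ A B : V, cross A (cross A B) = -(‖A‖ ^ 2) • B + ⟪A, B⟫ • A := by
  intro A B
  have skew (C D : V) : ⟪cross A C, D⟫ = -⟪cross A D, C⟫ := by
    have h := h₂ A (C + D)
    simp only [map_add, inner_add_left, inner_add_right, h₂] at h
    linarith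
  have polarized (C D : V) :
      ⟪cross A C, cross A D⟫ = ‖A‖ ^ 2 * ⟪C, D⟫ - ⟪A, C⟫ * ⟪A, D⟫ := by
    have h := h₃ A (C + D)
    rw [map_add, norm_add_sq_real, norm_add_sq_real, inner_add_right, h₃ A C, h₃ A D] at h
    linarith
  refine ext_inner_right ℝ fun C => ?_
  rw [skew, real_inner_comm, polarized, inner_add_left, real_inner_smul_left,
    real_inner_smul_left]
  ring
end

section
/- Let × be a cross product on a real inner product space V. Then the polarized Malcev identity holds: for all A, B, C ∈ V, A × (C × B) + C × (A × B) = ⟨A, B⟩ C + ⟨C, B⟩ A − 2⟨A, C⟩ B. -/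
open RealInnerProductSpace

section CrossProduct

variable {V : Type*} [NormedAddCommGroup V] [InnerProductSpace ℝ V] (cross : V →ₗ[ℝ] V →ₗ[ℝ] V)

/-- If `A × X` is always orthogonal to `X`, then `A × ·` is skew-adjoint. -/
theorem inner_cross_left_eq_neg (h₂ : ∀ A B : V, ⟪cross A B, B⟫ = 0) (A X D : V) :
    ⟪cross A X, D⟫ = -⟪cross A D, X⟫ := by
  have h := h₂ A (X + D)
  simp only [map_add, inner_add_left, inner_add_right, h₂] at h
  linarith

/-- Polarization of the norm identity in the first factor. -/
theorem inner_cross_cross_same_right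
    (h₃ : ∀ A B : V, ‖cross A B‖ ^ 2 = ‖A‖ ^ 2 * ‖B‖ ^ 2 - ⟪A, B⟫ ^ 2) (A C B : V) :
    ⟪cross A B, cross C B⟫ = ⟪A, C⟫ * ⟪B, B⟫ - ⟪A, B⟫ * ⟪C, B⟫ := by
  have h := h₃ (A + C) B
  have hA := h₃ A B
  have hC := h₃ C B
  simp only [← real_inner_self_eq_norm_sq, map_add, LinearMap.add_apply, inner_add_left,
    inner_add_right] at h hA hC
  rw [real_inner_comm (cross A B) (cross C B), real_inner_comm A C] at h
  linarith

/-- Polarization of the norm identity in both factors. -/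
theorem inner_cross_cross_add_inner_cross_cross
    (h₃ : ∀ A B : V, ‖cross A B‖ ^ 2 = ‖A‖ ^ 2 * ‖B‖ ^ 2 - ⟪A, B⟫ ^ 2) (A B C D : V) :
    ⟪cross A B, cross C D⟫ + ⟪cross A D, cross C B⟫
      = 2 * ⟪A, C⟫ * ⟪B, D⟫ - ⟪A, B⟫ * ⟪C, D⟫ - ⟪A, D⟫ * ⟪C, B⟫ := by
  have h := inner_cross_cross_same_right cross h₃ A C (B + D)
  have hB := inner_cross_cross_same_right cross h₃ A C B
  have hD := inner_cross_cross_same_right cross h₃ A C D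
  simp only [map_add, inner_add_left, inner_add_right] at h
  rw [real_inner_comm B D] at h
  linarith

end CrossProduct

/-- For a cross product on a real inner product space, the
polarized Malcev identity
`A × (C × B) + C × (A × B) = ⟪A, B⟫ C + ⟪C, B⟫ A − 2⟪A, C⟫ B` holds. -/
theorem cross_polarized_malcev_identity
    {V : Type*} [NormedAddCommGroup V] [InnerProductSpace ℝ V]
    (cross : V →ₗ[ℝ] V →ₗ[ℝ] V)
    (h₁ : ∀ A B : V, ⟪cross A B, A⟫ = 0)
    (h₂ : ∀ A B : V, ⟪cross A B, B⟫ = 0)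
    (h₃ : ∀ A B : V, ‖cross A B‖ ^ 2 = ‖A‖ ^ 2 * ‖B‖ ^ 2 - ⟪A, B⟫ ^ 2) :
    ∀ A B C : V, cross A (cross C B) + cross C (cross A B)
      = ⟪A, B⟫ • C + ⟪C, B⟫ • A - (2 * ⟪A, C⟫) • B := by
  intro A B C
  refine ext_inner_right ℝ fun D => ?_
  have h := inner_cross_cross_add_inner_cross_cross cross h₃ A B C D
  simp only [inner_add_left, inner_sub_left, real_inner_smul_left]
  rw [inner_cross_left_eq_neg cross h₂ A (cross C B), inner_cross_left_eq_neg cross h₂ C (cross A B),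
    real_inner_comm (cross A B) (cross C D)]
  linarith
end

section
/- Let × be a cross product on a real inner product space V and let A, B, C ∈ V with ⟨C, A⟩ = 0 and ⟨C, B⟩ = 0. Then (A × B) × C = −A × (B × C) − ⟨A, B⟩ C. -/
open RealInnerProductSpace

section CrossProduct

variable {V : Type*} [NormedAddCommGroup V] [InnerProductSpace ℝ V] {cross : V →ₗ[ℝ] V →ₗ[ℝ] V}

/-- A bilinear map satisfying the norm identity of a cross product is antisymmetric. -/
theorem cross_antisymm
    (h₃ : ∀ A B : V, ‖cross A B‖ ^ 2 = ‖A‖ ^ 2 * ‖B‖ ^ 2 - ⟪A, B⟫ ^ 2) (A B : V) :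
    cross A B = -cross B A := by
  have hself (X : V) : cross X X = 0 := by
    have h := h₃ X X
    rw [real_inner_self_eq_norm_sq] at h
    have h0 : ‖cross X X‖ ^ 2 = 0 := by rw [h]; ring
    simpa using h0
  have h := hself (A + B)
  simp only [map_add, LinearMap.add_apply, hself, zero_add, add_zero] at h
  exact eq_neg_of_add_eq_zero_right h

/-- Left multiplication by a vector is skew-adjoint. -/
theorem inner_cross_eq_neg (h₂ : ∀ A B : V, ⟪cross A B, B⟫ = 0) (A B C : V) :
    ⟪cross A B, C⟫ = -⟪B, cross A C⟫ := by
  have h := h₂ A (B + C)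
  simp only [map_add, inner_add_left, inner_add_right, h₂] at h
  rw [real_inner_comm (cross A C) B]
  linarith

theorem inner_cross_cross
    (h₃ : ∀ A B : V, ‖cross A B‖ ^ 2 = ‖A‖ ^ 2 * ‖B‖ ^ 2 - ⟪A, B⟫ ^ 2) (A B C : V) :
    ⟪cross A B, cross A C⟫ = ‖A‖ ^ 2 * ⟪B, C⟫ - ⟪A, B⟫ * ⟪A, C⟫ := by
  have h := h₃ A (B + C)
  rw [map_add, norm_add_sq_real, norm_add_sq_real, inner_add_right, h₃, h₃] at h
  linarith

theorem cross_cross_self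
    (h₂ : ∀ A B : V, ⟪cross A B, B⟫ = 0)
    (h₃ : ∀ A B : V, ‖cross A B‖ ^ 2 = ‖A‖ ^ 2 * ‖B‖ ^ 2 - ⟪A, B⟫ ^ 2) (A B : V) :
    cross A (cross A B) = ⟪A, B⟫ • A - ‖A‖ ^ 2 • B := by
  refine ext_inner_right ℝ fun W => ?_
  rw [inner_cross_eq_neg h₂, inner_cross_cross h₃, inner_sub_left, real_inner_smul_left,
    real_inner_smul_left]
  ring

/-- The polarization of `cross_cross_self` in its first argument. -/
theorem cross_cross_add_cross_cross
    (h₂ : ∀ A B : V, ⟪cross A B, B⟫ = 0)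
    (h₃ : ∀ A B : V, ‖cross A B‖ ^ 2 = ‖A‖ ^ 2 * ‖B‖ ^ 2 - ⟪A, B⟫ ^ 2) (A B C : V) :
    cross A (cross B C) + cross B (cross A C) =
      ⟪A, C⟫ • B + ⟪B, C⟫ • A - (2 * ⟪A, B⟫) • C := by
  have h := cross_cross_self h₂ h₃ (A + B) C
  simp only [map_add, LinearMap.add_apply, cross_cross_self h₂ h₃, norm_add_sq_real,
    inner_add_left] at h
  linear_combination (norm := module) h

end CrossProduct

/-- For a cross product on a real inner product space and vectors
`A, B, C` with `C` orthogonal to `A` and `B`, one has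
`(A × B) × C = −A × (B × C) − ⟪A, B⟫ C`. -/
theorem cross_associator_identity
    {V : Type*} [NormedAddCommGroup V] [InnerProductSpace ℝ V]
    (cross : V →ₗ[ℝ] V →ₗ[ℝ] V)
    (h₁ : ∀ A B : V, ⟪cross A B, A⟫ = 0)
    (h₂ : ∀ A B : V, ⟪cross A B, B⟫ = 0)
    (h₃ : ∀ A B : V, ‖cross A B‖ ^ 2 = ‖A‖ ^ 2 * ‖B‖ ^ 2 - ⟪A, B⟫ ^ 2)
    (A B C : V) (hCA : ⟪C, A⟫ = 0) (hCB : ⟪C, B⟫ = 0) :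
    cross (cross A B) C = -cross A (cross B C) - ⟪A, B⟫ • C := by
  have h := cross_cross_add_cross_cross h₂ h₃ C A B
  rw [hCA, hCB, cross_antisymm h₃ C (cross A B), cross_antisymm h₃ C B, map_neg] at h
  linear_combination (norm := module) -h
end

section
/- Let V be a real inner product space and J : V → V a linear map with J∘J = −id. Let A : V × V × V → ℝ be a trilinear form satisfying the nearly Kähler condition A(X,X,Z) = 0 for all X, Z ∈ V. Suppose T : V × V × V → ℝ is a totally antisymmetric trilinear form (a 3-form) satisfying 0 = A(X,Y,Z) + (1/2) T(X, J(Y), Z) + (1/2) T(X, Y, J(Z)) for all X, Y, Z ∈ V. Then T is uniquely determined: T(X,Y,Z) = A(X, J(Y), Z) for all X, Y, Z ∈ V. (With A(X,Y,Z) = ⟨(∇ᵍ_X J)Y, Z⟩, this is the uniqueness and the explicit formula for the torsion of the characteristic connection of a nearly Kähler manifold.) -/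
open RealInnerProductSpace

/-- Pointwise uniqueness and explicit formula for the torsion of
the characteristic connection of a nearly Kähler manifold: if `J² = −id`, the
trilinear form `A` satisfies the nearly Kähler condition `A(X,X,Z) = 0`, and
the totally antisymmetric trilinear form `T` satisfies
`0 = A(X,Y,Z) + ½ T(X,JY,Z) + ½ T(X,Y,JZ)`, then `T(X,Y,Z) = A(X,JY,Z)`. -/
theorem characteristic_torsion_unique_formula
    {V : Type*} [NormedAddCommGroup V] [InnerProductSpace ℝ V]
    (J : V →ₗ[ℝ] V) (hJ : J ∘ₗ J = -LinearMap.id)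
    (A : V →ₗ[ℝ] V →ₗ[ℝ] V →ₗ[ℝ] ℝ)
    (hA : ∀ X Z : V, A X X Z = 0)
    (T : V →ₗ[ℝ] V →ₗ[ℝ] V →ₗ[ℝ] ℝ)
    (hTswap₁ : ∀ X Y Z : V, T Y X Z = -T X Y Z)
    (hTswap₂ : ∀ X Y Z : V, T X Z Y = -T X Y Z)
    (hcompat : ∀ X Y Z : V,
      0 = A X Y Z + (1 / 2) * T X (J Y) Z + (1 / 2) * T X Y (J Z)) :
    ∀ X Y Z : V, T X Y Z = A X (J Y) Z := by
  have hJJ (Y : V) : J (J Y) = -Y := by simpa using LinearMap.congr_fun hJ Y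
  have hAskew (X Y Z : V) : A X Y Z + A Y X Z = 0 := by
    have h := hA (X + Y) Z
    simp only [map_add, LinearMap.add_apply, hA] at h
    linarith
  have hmove₁ (X Y Z : V) : T X (J Y) Z = T (J X) Y Z := by
    linarith [hAskew X Y Z, hcompat X Y Z, hcompat Y X Z, hTswap₁ X Y (J Z),
      hTswap₁ (J X) Y Z]
  have hmove₂ (X Y Z : V) : T X Y (J Z) = T X (J Y) Z := by
    linarith [hmove₁ Y Z X, hTswap₁ X Y (J Z), hTswap₂ Y X (J Z),
      hTswap₁ X (J Y) Z, hTswap₂ (J Y) X Z]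
  intro X Y Z
  have h₁ := hcompat X (J Y) Z
  have h₂ := hmove₂ X (J Y) Z
  simp only [hJJ, map_neg, LinearMap.neg_apply] at h₁ h₂
  linarith
end

section
/- Let c : ℝ⁶ → End(ℝ⁸) be a linear map (ℝ⁶ and ℝ⁸ Euclidean spaces) such that c(X)∘c(Y) + c(Y)∘c(X) = −2⟨X,Y⟩·id for all X, Y ∈ ℝ⁶ and such that each c(X) is skew-adjoint; let J := c(e₁)∘⋯∘c(e₆) for the standard orthonormal basis of ℝ⁶. Let φ ∈ ℝ⁸ be nonzero. Then ⟨c(X)φ, c(Y)φ⟩ = ⟨X,Y⟩‖φ‖² for all X, Y ∈ ℝ⁶ (so X ↦ c(X)φ is injective), the three subspaces ℝφ, ℝ·J(φ) and W_φ := {c(X)φ : X ∈ ℝ⁶} are pairwise orthogonal, and ℝ⁸ is their direct sum: ℝ⁸ = ℝφ ⊕ ℝ·J(φ) ⊕ W_φ. -/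
open RealInnerProductSpace

/-- The standard orthonormal basis vector `eᵢ` of `ℝ⁶`. -/
noncomputable def stdBasisVec (i : Fin 6) : EuclideanSpace ℝ (Fin 6) :=
  EuclideanSpace.single i (1 : ℝ)

section Clifford

variable {V S : Type*} [NormedAddCommGroup V] [InnerProductSpace ℝ V]
  [NormedAddCommGroup S] [InnerProductSpace ℝ S] {c : V →ₗ[ℝ] (S →ₗ[ℝ] S)}

lemma clifford_apply_add (hclif : ∀ X Y : V, c X ∘ₗ c Y + c Y ∘ₗ c X = (-2 * ⟪X, Y⟫) • LinearMap.id)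
    (X Y : V) (v : S) : c X (c Y v) + c Y (c X v) = (-2 * ⟪X, Y⟫) • v := by
  simpa using LinearMap.congr_fun (hclif X Y) v

lemma inner_clifford_clifford
    (hclif : ∀ X Y : V, c X ∘ₗ c Y + c Y ∘ₗ c X = (-2 * ⟪X, Y⟫) • LinearMap.id)
    (hskew : ∀ (X : V) (u v : S), ⟪c X u, v⟫ = -⟪u, c X v⟫) (X Y : V) (φ : S) :
    ⟪c X φ, c Y φ⟫ = ⟪X, Y⟫ * ‖φ‖ ^ 2 := by
  have h := congrArg (fun v => ⟪φ, v⟫) (clifford_apply_add hclif X Y φ)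
  simp only [inner_add_right, inner_smul_right, real_inner_self_eq_norm_sq] at h
  have h1 := hskew X φ (c Y φ)
  have h2 := hskew Y φ (c X φ)
  rw [real_inner_comm] at h2
  linarith

lemma norm_clifford_apply
    (hclif : ∀ X Y : V, c X ∘ₗ c Y + c Y ∘ₗ c X = (-2 * ⟪X, Y⟫) • LinearMap.id)
    (hskew : ∀ (X : V) (u v : S), ⟪c X u, v⟫ = -⟪u, c X v⟫) (X : V) (φ : S) :
    ‖c X φ‖ = ‖X‖ * ‖φ‖ := by
  have h := inner_clifford_clifford hclif hskew X X φ
  rw [real_inner_self_eq_norm_sq, real_inner_self_eq_norm_sq, ← mul_pow] at h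
  exact (sq_eq_sq₀ (norm_nonneg _) (by positivity)).1 h

lemma clifford_apply_injective
    (hclif : ∀ X Y : V, c X ∘ₗ c Y + c Y ∘ₗ c X = (-2 * ⟪X, Y⟫) • LinearMap.id)
    (hskew : ∀ (X : V) (u v : S), ⟪c X u, v⟫ = -⟪u, c X v⟫) {φ : S} (hφ : φ ≠ 0) :
    Function.Injective (c.flip φ) := by
  refine (injective_iff_map_eq_zero _).2 fun X hX => ?_
  have h := norm_clifford_apply hclif hskew X φ
  rw [← LinearMap.flip_apply, hX, norm_zero, eq_comm, mul_eq_zero] at h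
  simpa [hφ] using h

end Clifford

section Volume

variable {S : Type*} [NormedAddCommGroup S] [InnerProductSpace ℝ S]
  {c : EuclideanSpace ℝ (Fin 6) →ₗ[ℝ] (S →ₗ[ℝ] S)}

lemma stdBasisVec_clifford_anticomm
    (hclif : ∀ X Y, c X ∘ₗ c Y + c Y ∘ₗ c X = (-2 * ⟪X, Y⟫) • LinearMap.id)
    {i j : Fin 6} (hij : j < i) (v : S) :
    c (stdBasisVec i) (c (stdBasisVec j) v) = -c (stdBasisVec j) (c (stdBasisVec i) v) := by
  have h := clifford_apply_add hclif (stdBasisVec i) (stdBasisVec j) v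
  rw [eq_neg_iff_add_eq_zero, h]
  simp [stdBasisVec, EuclideanSpace.inner_single_left, hij.ne]

lemma stdBasisVec_clifford_sq
    (hclif : ∀ X Y, c X ∘ₗ c Y + c Y ∘ₗ c X = (-2 * ⟪X, Y⟫) • LinearMap.id)
    (i : Fin 6) (v : S) : c (stdBasisVec i) (c (stdBasisVec i) v) = -v := by
  have h := clifford_apply_add hclif (stdBasisVec i) (stdBasisVec i) v
  have h' : ⟪stdBasisVec i, stdBasisVec i⟫ = 1 := by simp [stdBasisVec]
  rw [h', mul_one, ← two_smul ℝ, neg_smul, ← smul_neg] at h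
  exact smul_right_injective S (two_ne_zero (α := ℝ)) h

/-- The action of the volume element `e₁ ⋯ e₆`. -/
noncomputable def volumeElement (c : EuclideanSpace ℝ (Fin 6) →ₗ[ℝ] (S →ₗ[ℝ] S)) : S →ₗ[ℝ] S :=
  c (stdBasisVec 0) ∘ₗ c (stdBasisVec 1) ∘ₗ c (stdBasisVec 2) ∘ₗ
    c (stdBasisVec 3) ∘ₗ c (stdBasisVec 4) ∘ₗ c (stdBasisVec 5)

lemma inner_volumeElement_left
    (hclif : ∀ X Y, c X ∘ₗ c Y + c Y ∘ₗ c X = (-2 * ⟪X, Y⟫) • LinearMap.id)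
    (hskew : ∀ X (u v : S), ⟪c X u, v⟫ = -⟪u, c X v⟫) (u v : S) :
    ⟪volumeElement c u, v⟫ = -⟪u, volumeElement c v⟫ := by
  simp (disch := decide) only [volumeElement, LinearMap.comp_apply, hskew,
    stdBasisVec_clifford_anticomm hclif, map_neg, inner_neg_right, neg_neg]

lemma norm_volumeElement_apply
    (hclif : ∀ X Y, c X ∘ₗ c Y + c Y ∘ₗ c X = (-2 * ⟪X, Y⟫) • LinearMap.id)
    (hskew : ∀ X (u v : S), ⟪c X u, v⟫ = -⟪u, c X v⟫) (v : S) :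
    ‖volumeElement c v‖ = ‖v‖ := by
  have h (i : Fin 6) : ‖stdBasisVec i‖ = 1 := by simp [stdBasisVec]
  simp only [volumeElement, LinearMap.comp_apply, norm_clifford_apply hclif hskew, h, one_mul]

lemma volumeElement_clifford
    (hclif : ∀ X Y, c X ∘ₗ c Y + c Y ∘ₗ c X = (-2 * ⟪X, Y⟫) • LinearMap.id)
    (X : EuclideanSpace ℝ (Fin 6)) (v : S) :
    volumeElement c (c X v) = -c X (volumeElement c v) := by
  suffices h : volumeElement c ∘ₗ c.flip v = -c.flip (volumeElement c v) from
    LinearMap.congr_fun h X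
  refine (EuclideanSpace.basisFun (Fin 6) ℝ).toBasis.ext fun i => ?_
  rw [OrthonormalBasis.coe_toBasis, EuclideanSpace.basisFun_apply]
  change volumeElement c (c (stdBasisVec i) v) = -c (stdBasisVec i) (volumeElement c v)
  fin_cases i <;>
  simp (disch := decide) [volumeElement, stdBasisVec_clifford_anticomm hclif,
    stdBasisVec_clifford_sq hclif]

lemma inner_volumeElement_clifford
    (hclif : ∀ X Y, c X ∘ₗ c Y + c Y ∘ₗ c X = (-2 * ⟪X, Y⟫) • LinearMap.id)
    (hskew : ∀ X (u v : S), ⟪c X u, v⟫ = -⟪u, c X v⟫)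
    (X : EuclideanSpace ℝ (Fin 6)) (φ : S) : ⟪volumeElement c φ, c X φ⟫ = 0 := by
  have h1 := inner_volumeElement_left hclif hskew φ (c X φ)
  rw [volumeElement_clifford hclif, inner_neg_right, neg_neg] at h1
  have h2 := hskew X φ (volumeElement c φ)
  rw [real_inner_comm] at h2
  linarith

end Volume

lemma inner_self_apply_eq_zero_of_skew {S : Type*} [NormedAddCommGroup S] [InnerProductSpace ℝ S]
    {A : S →ₗ[ℝ] S} (hA : ∀ u v, ⟪A u, v⟫ = -⟪u, A v⟫) (v : S) : ⟪v, A v⟫ = 0 := by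
  have h := hA v v
  rw [real_inner_comm] at h
  linarith

lemma Submodule.finrank_sup_of_isOrtho {S : Type*} [NormedAddCommGroup S] [InnerProductSpace ℝ S]
    [FiniteDimensional ℝ S] {U W : Submodule ℝ S} (h : U ⟂ W) :
    Module.finrank ℝ ↥(U ⊔ W) = Module.finrank ℝ U + Module.finrank ℝ W := by
  have h' := Submodule.finrank_sup_add_finrank_inf_eq U W
  rwa [h.disjoint.eq_bot, finrank_bot, add_zero] at h'

/-- With `c` a skew-adjoint Clifford multiplication of `ℝ⁶` on
`ℝ⁸` and `J := c(e₁)∘⋯∘c(e₆)`, any nonzero spinor `φ ∈ ℝ⁸` satisfies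
`⟪c(X)φ, c(Y)φ⟫ = ⟪X,Y⟫‖φ‖²` (so `X ↦ c(X)φ` is injective), the subspaces
`ℝφ`, `ℝ·J(φ)` and `W_φ = {c(X)φ}` are pairwise orthogonal, and `ℝ⁸` is their
direct sum. -/
theorem spinor_decomposition_of_spin_representation
    (c : EuclideanSpace ℝ (Fin 6) →ₗ[ℝ]
      (EuclideanSpace ℝ (Fin 8) →ₗ[ℝ] EuclideanSpace ℝ (Fin 8)))
    (hclif : ∀ X Y : EuclideanSpace ℝ (Fin 6),
      c X ∘ₗ c Y + c Y ∘ₗ c X = (-2 * ⟪X, Y⟫) • LinearMap.id)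
    (hskew : ∀ (X : EuclideanSpace ℝ (Fin 6)) (u v : EuclideanSpace ℝ (Fin 8)),
      ⟪c X u, v⟫ = -⟪u, c X v⟫)
    (J : EuclideanSpace ℝ (Fin 8) →ₗ[ℝ] EuclideanSpace ℝ (Fin 8))
    (hJ : J = c (stdBasisVec 0) ∘ₗ c (stdBasisVec 1) ∘ₗ c (stdBasisVec 2) ∘ₗ
      c (stdBasisVec 3) ∘ₗ c (stdBasisVec 4) ∘ₗ c (stdBasisVec 5))
    (φ : EuclideanSpace ℝ (Fin 8)) (hφ : φ ≠ 0) :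
    (∀ X Y : EuclideanSpace ℝ (Fin 6), ⟪c X φ, c Y φ⟫ = ⟪X, Y⟫ * ‖φ‖ ^ 2) ∧
    Function.Injective (fun X : EuclideanSpace ℝ (Fin 6) => c X φ) ∧
    (∀ u ∈ (ℝ ∙ φ), ∀ v ∈ (ℝ ∙ (J φ)), ⟪u, v⟫ = 0) ∧
    (∀ u ∈ (ℝ ∙ φ), ∀ w ∈ LinearMap.range (c.flip φ), ⟪u, w⟫ = 0) ∧
    (∀ v ∈ (ℝ ∙ (J φ)), ∀ w ∈ LinearMap.range (c.flip φ), ⟪v, w⟫ = 0) ∧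
    (ℝ ∙ φ) ⊔ (ℝ ∙ (J φ)) ⊔ LinearMap.range (c.flip φ) = ⊤ := by
  change J = volumeElement c at hJ
  subst hJ
  have hinj := clifford_apply_injective hclif hskew hφ
  have hJφ : volumeElement c φ ≠ 0 := by
    rwa [← norm_ne_zero_iff, norm_volumeElement_apply hclif hskew, norm_ne_zero_iff]
  have h1 : (ℝ ∙ φ) ⟂ (ℝ ∙ (volumeElement c φ)) :=
    Submodule.isOrtho_span.2 (by
      simpa using inner_self_apply_eq_zero_of_skew (inner_volumeElement_left hclif hskew) φ)
  have h2 : (ℝ ∙ φ) ⟂ LinearMap.range (c.flip φ) := by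
    rw [← Submodule.span_eq (LinearMap.range (c.flip φ)), Submodule.isOrtho_span]
    rintro _ rfl _ ⟨X, rfl⟩
    exact inner_self_apply_eq_zero_of_skew (hskew X) _
  have h3 : (ℝ ∙ (volumeElement c φ)) ⟂ LinearMap.range (c.flip φ) := by
    rw [← Submodule.span_eq (LinearMap.range (c.flip φ)), Submodule.isOrtho_span]
    rintro _ rfl _ ⟨X, rfl⟩
    exact inner_volumeElement_clifford hclif hskew X φ
  refine ⟨fun X Y => inner_clifford_clifford hclif hskew X Y φ, hinj,
    fun u hu v hv => h1.inner_eq hu hv, fun u hu v hv => h2.inner_eq hu hv,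
    fun u hu v hv => h3.inner_eq hu hv, Submodule.eq_top_of_finrank_eq ?_⟩
  rw [Submodule.finrank_sup_of_isOrtho (Submodule.isOrtho_sup_left.2 ⟨h2, h3⟩),
    Submodule.finrank_sup_of_isOrtho h1, finrank_span_singleton hφ, finrank_span_singleton hJφ,
    LinearMap.finrank_range_of_inj hinj, finrank_euclideanSpace_fin, finrank_euclideanSpace_fin]
end

section
/- Let c : ℝ⁶ → End(ℝ⁸) be a linear map (ℝ⁶ and ℝ⁸ Euclidean spaces) such that c(X)∘c(Y) + c(Y)∘c(X) = −2⟨X,Y⟩·id for all X, Y ∈ ℝ⁶ and such that each c(X) is skew-adjoint; let J := c(e₁)∘⋯∘c(e₆) for the standard orthonormal basis of ℝ⁶. Let φ ∈ ℝ⁸ be a unit vector. Then J preserves the subspace {c(X)φ : X ∈ ℝ⁶}, and there is a unique linear map J_φ : ℝ⁶ → ℝ⁶ such that c(J_φ(X))φ = J(c(X)φ) for all X ∈ ℝ⁶; moreover J_φ∘J_φ = −id and ⟨J_φ(X), J_φ(Y)⟩ = ⟨X,Y⟩ for all X, Y ∈ ℝ⁶, i.e. J_φ is an orthogonal complex structure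 on ℝ⁶ depending on the spinor φ. -/
open RealInnerProductSpace

section OrderedProducts

variable {V : Type*} [AddCommGroup V] [Module ℝ V] {A : Fin 6 → V →ₗ[ℝ] V}

/-- The product of six anticommuting square roots of `-1` squares to `-1`. -/
theorem anticommuting_product_sq (hsq : ∀ i v, A i (A i v) = -v)
    (hanti : ∀ i j, i < j → ∀ v, A j (A i v) = -A i (A j v)) (v : V) :
    A 0 (A 1 (A 2 (A 3 (A 4 (A 5 (A 0 (A 1 (A 2 (A 3 (A 4 (A 5 v))))))))))) = -v := by
  simp [hsq, hanti]

/-- The product of six anticommuting square roots of `-1` anticommutes with each factor. -/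
theorem anticommuting_product_anticomm (hsq : ∀ i v, A i (A i v) = -v)
    (hanti : ∀ i j, i < j → ∀ v, A j (A i v) = -A i (A j v)) (i : Fin 6) (v : V) :
    A 0 (A 1 (A 2 (A 3 (A 4 (A 5 (A i v)))))) = -A i (A 0 (A 1 (A 2 (A 3 (A 4 (A 5 v)))))) := by
  fin_cases i <;> simp [hsq, hanti]

/-- Reversing the product of six anticommuting maps changes its sign. -/
theorem anticommuting_product_reverse
    (hanti : ∀ i j, i < j → ∀ v, A j (A i v) = -A i (A j v)) (v : V) :
    A 5 (A 4 (A 3 (A 2 (A 1 (A 0 v))))) = -A 0 (A 1 (A 2 (A 3 (A 4 (A 5 v))))) := by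
  simp [hanti]

end OrderedProducts

section SpinorOrbit

variable {E S : Type*} [NormedAddCommGroup E] [InnerProductSpace ℝ E]
  [NormedAddCommGroup S] [InnerProductSpace ℝ S]
  {c : E →ₗ[ℝ] S →ₗ[ℝ] S} {J : S →ₗ[ℝ] S} {φ : S}

/-- Clifford multiplication of a unit spinor by vectors is an isometry. -/
theorem inner_clifford_apply_unit
    (hclif : ∀ X Y v, c X (c Y v) + c Y (c X v) = (-2 * ⟪X, Y⟫) • v)
    (hskew : ∀ X u v, ⟪c X u, v⟫ = -⟪u, c X v⟫) (hφ : ‖φ‖ = 1) (X Y : E) :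
    ⟪c X φ, c Y φ⟫ = ⟪X, Y⟫ := by
  have h := congrArg (fun v => ⟪φ, v⟫) (hclif X Y φ)
  simp only [inner_add_right, inner_smul_right, real_inner_self_eq_norm_sq, hφ] at h
  linarith [hskew X φ (c Y φ), hskew Y φ (c X φ), real_inner_comm (c X φ) (c Y φ)]

/-- A skew map `J` anticommuting with the skew map `c X` satisfies `c X φ ⟂ φ` and `c X φ ⟂ J φ`. -/
theorem inner_clifford_apply_eq_zero
    (hskew : ∀ X u v, ⟪c X u, v⟫ = -⟪u, c X v⟫) (hJskew : ∀ u v, ⟪J u, v⟫ = -⟪u, J v⟫)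
    (hJc : ∀ X v, J (c X v) = -c X (J v)) (φ : S) (X : E) :
    ⟪φ, c X φ⟫ = 0 ∧ ⟪J φ, c X φ⟫ = 0 := by
  constructor
  · linarith [hskew X φ φ, real_inner_comm φ (c X φ)]
  · have h := hJskew φ (c X φ)
    rw [hJc, inner_neg_right, neg_neg] at h
    linarith [hskew X φ (J φ), real_inner_comm (J φ) (c X φ)]

/-- A vector is orthogonal to the span of a pair iff it is orthogonal to both vectors. -/
theorem mem_orthogonal_span_pair {u v w : S} :
    w ∈ (Submodule.span ℝ (Set.range ![u, v]))ᗮ ↔ ⟪u, w⟫ = 0 ∧ ⟪v, w⟫ = 0 := by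
  rw [← Submodule.span_singleton_le_iff_mem, ← Submodule.isOrtho_iff_le, Submodule.isOrtho_comm,
    Submodule.isOrtho_span]
  simp [and_comm]

/-- In dimensions `6` and `8`, the vectors `c X φ` form the orthogonal complement of
`φ` and `J φ`, for `J` a skew complex structure anticommuting with `c`. -/
theorem range_flip_eq_orthogonal [FiniteDimensional ℝ S]
    (hE : Module.finrank ℝ E = 6) (hS : Module.finrank ℝ S = 8)
    (hskew : ∀ X u v, ⟪c X u, v⟫ = -⟪u, c X v⟫)
    (hiso : ∀ X Y, ⟪c X φ, c Y φ⟫ = ⟪X, Y⟫)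
    (hJ2 : ∀ v, J (J v) = -v) (hJskew : ∀ u v, ⟪J u, v⟫ = -⟪u, J v⟫)
    (hJc : ∀ X v, J (c X v) = -c X (J v)) (hφ : ‖φ‖ = 1) :
    LinearMap.range (c.flip φ) = (Submodule.span ℝ (Set.range ![φ, J φ]))ᗮ := by
  have hinj : Function.Injective (c.flip φ) := by
    rw [injective_iff_map_eq_zero]
    intro X hX
    rw [LinearMap.flip_apply] at hX
    rw [← inner_self_eq_zero (𝕜 := ℝ), ← hiso, hX, inner_zero_left]
  have hφJ : ⟪φ, J φ⟫ = 0 := by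
    linarith [hJskew φ φ, real_inner_comm φ (J φ)]
  have hJJ : ⟪J φ, J φ⟫ = 1 := by
    rw [hJskew, hJ2, inner_neg_right, real_inner_self_eq_norm_sq, hφ]; norm_num
  have hon : Orthonormal ℝ ![φ, J φ] := by
    rw [orthonormal_iff_ite]
    intro i j
    fin_cases i <;> fin_cases j <;>
      simp [hφ, hφJ, hJJ, real_inner_comm φ (J φ), -inner_self_eq_norm_sq_to_K,
        real_inner_self_eq_norm_sq]
  refine Submodule.eq_of_le_of_finrank_eq ?_ ?_
  · rintro _ ⟨X, rfl⟩
    exact mem_orthogonal_span_pair.2 (inner_clifford_apply_eq_zero hskew hJskew hJc φ X)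
  · have h := Submodule.finrank_add_finrank_orthogonal (Submodule.span ℝ (Set.range ![φ, J φ]))
    rw [finrank_span_eq_card hon.linearIndependent, hS, Fintype.card_fin] at h
    rw [LinearMap.finrank_range_of_inj hinj, hE]
    omega

end SpinorOrbit

/-- With `c` a skew-adjoint Clifford multiplication of `ℝ⁶` on
`ℝ⁸`, `J := c(e₁)∘⋯∘c(e₆)` and `φ` a unit spinor, `J` preserves the subspace
`{c(X)φ : X ∈ ℝ⁶}`, there is a unique linear map `J_φ : ℝ⁶ → ℝ⁶` with
`c(J_φ X)φ = J(c(X)φ)`, and any such `J_φ` satisfies `J_φ² = −id` and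
`⟪J_φ X, J_φ Y⟫ = ⟪X, Y⟫`, i.e. it is an orthogonal complex structure. -/
theorem spinor_induced_orthogonal_complex_structure
    (c : EuclideanSpace ℝ (Fin 6) →ₗ[ℝ]
      (EuclideanSpace ℝ (Fin 8) →ₗ[ℝ] EuclideanSpace ℝ (Fin 8)))
    (hclif : ∀ X Y : EuclideanSpace ℝ (Fin 6),
      c X ∘ₗ c Y + c Y ∘ₗ c X = (-2 * ⟪X, Y⟫) • LinearMap.id)
    (hskew : ∀ (X : EuclideanSpace ℝ (Fin 6)) (u v : EuclideanSpace ℝ (Fin 8)),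
      ⟪c X u, v⟫ = -⟪u, c X v⟫)
    (J : EuclideanSpace ℝ (Fin 8) →ₗ[ℝ] EuclideanSpace ℝ (Fin 8))
    (hJ : J = c (stdBasisVec 0) ∘ₗ c (stdBasisVec 1) ∘ₗ c (stdBasisVec 2) ∘ₗ
      c (stdBasisVec 3) ∘ₗ c (stdBasisVec 4) ∘ₗ c (stdBasisVec 5))
    (φ : EuclideanSpace ℝ (Fin 8)) (hφ : ‖φ‖ = 1) :
    (∀ X : EuclideanSpace ℝ (Fin 6), J (c X φ) ∈ LinearMap.range (c.flip φ)) ∧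
    (∃! Jφ : EuclideanSpace ℝ (Fin 6) →ₗ[ℝ] EuclideanSpace ℝ (Fin 6),
      ∀ X : EuclideanSpace ℝ (Fin 6), c (Jφ X) φ = J (c X φ)) ∧
    (∀ Jφ : EuclideanSpace ℝ (Fin 6) →ₗ[ℝ] EuclideanSpace ℝ (Fin 6),
      (∀ X : EuclideanSpace ℝ (Fin 6), c (Jφ X) φ = J (c X φ)) →
        Jφ ∘ₗ Jφ = -LinearMap.id ∧
        ∀ X Y : EuclideanSpace ℝ (Fin 6), ⟪Jφ X, Jφ Y⟫ = ⟪X, Y⟫) := by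
  have hclif' : ∀ X Y v, c X (c Y v) + c Y (c X v) = (-2 * ⟪X, Y⟫) • v :=
    fun X Y v => LinearMap.congr_fun (hclif X Y) v
  have hinner : ∀ i j, ⟪stdBasisVec i, stdBasisVec j⟫ = if i = j then 1 else 0 := by
    intro i j
    simp [stdBasisVec, EuclideanSpace.inner_single_left]
  have hsq : ∀ i v, c (stdBasisVec i) (c (stdBasisVec i) v) = -v := by
    intro i v
    have h := hclif' (stdBasisVec i) (stdBasisVec i) v
    rw [hinner, if_pos rfl, ← two_smul ℝ, mul_one, neg_smul, ← smul_neg] at h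
    exact smul_right_injective _ two_ne_zero h
  have hanti : ∀ i j, i < j → ∀ v,
      c (stdBasisVec j) (c (stdBasisVec i) v) = -c (stdBasisVec i) (c (stdBasisVec j) v) := by
    intro i j hij v
    have h := hclif' (stdBasisVec j) (stdBasisVec i) v
    rw [hinner, if_neg hij.ne', mul_zero, zero_smul] at h
    exact eq_neg_of_add_eq_zero_left h
  have hJ2 : ∀ v, J (J v) = -v := by
    intro v
    simpa only [hJ, LinearMap.comp_apply] using anticommuting_product_sq (A := fun i => c (stdBasisVec i)) hsq hanti v
  have hJskew : ∀ u v, ⟪J u, v⟫ = -⟪u, J v⟫ := by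
    intro u v
    have h := anticommuting_product_reverse (A := fun i => c (stdBasisVec i)) hanti v
    simp only [hJ, LinearMap.comp_apply, hskew, neg_neg]
    rw [h, inner_neg_right]
  have hJc : ∀ X v, J (c X v) = -c X (J v) := by
    intro X v
    have hlin : J ∘ₗ c.flip v = -c.flip (J v) := by
      refine (EuclideanSpace.basisFun (Fin 6) ℝ).toBasis.ext fun i => ?_
      have h := anticommuting_product_anticomm (A := fun i => c (stdBasisVec i)) hsq hanti i v
      simpa [hJ, stdBasisVec] using h
    exact LinearMap.congr_fun hlin X
  have hiso := inner_clifford_apply_unit hclif' hskew hφ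
  have hinj : ∀ {X Y}, c X φ = c Y φ → X = Y := by
    intro X Y h
    rw [← sub_eq_zero, ← inner_self_eq_zero (𝕜 := ℝ), ← hiso, map_sub, LinearMap.sub_apply, h,
      sub_self, inner_zero_left]
  have hrange := range_flip_eq_orthogonal (finrank_euclideanSpace_fin) (finrank_euclideanSpace_fin)
    hskew hiso hJ2 hJskew hJc hφ
  have hmem : ∀ X, J (c X φ) ∈ LinearMap.range (c.flip φ) := by
    intro X
    obtain ⟨h₁, h₂⟩ := inner_clifford_apply_eq_zero hskew hJskew hJc φ X
    rw [hrange, mem_orthogonal_span_pair]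
    constructor
    · linarith [hJskew φ (c X φ)]
    · rw [hJskew, hJ2, inner_neg_right, neg_neg, h₁]
  refine ⟨hmem, ?_, ?_⟩
  · choose f hf using hmem
    simp only [LinearMap.flip_apply] at hf
    refine ⟨{ toFun := f, map_add' := fun X Y => hinj ?_, map_smul' := fun r X => hinj ?_ }, hf,
      fun g hg => LinearMap.ext fun X => hinj ((hg X).trans (hf X).symm)⟩
    · simp [hf]
    · simp [hf]
  · intro Jφ h
    refine ⟨LinearMap.ext fun X => hinj ?_, fun X Y => ?_⟩
    · simp [h, hJ2]
    · rw [← hiso, h, h, hJskew, hJ2, inner_neg_right, neg_neg, hiso]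
end
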